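/- Let σ be an annular non-crossing partition of [1,n] ∪ [n+1,n+m] with exactly one through-block B (a block intersecting both [1,n] and [n+1,n+m]), and write B = B' ∪ B'' with B' = B ∩ [1,n] and B'' = B ∩ [n+1,n+m]. Then the number of annular non-crossing permutations π ∈ S_NC(n,m) whose cycle decomposition yields the partition σ is exactly |B'|·|B''|. If σ has more than one through-block, then there is exactly one such permutation π. -/

import Mathlib

/-- The number of cycles of a permutation, counting fixed points. -/
def cycleCount {α : Type*} [Fintype α] [DecidableEq α] (σ : Equiv.Perm α) : ℕ :=
  (Fintype.card α - σ.support.card) + σ.cycleType.card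

def annGamma (n m : ℕ) : Equiv.Perm (Fin (n + m)) :=
  Equiv.permCongr finSumFinEquiv (Equiv.Perm.sumCongr (finRotate n) (finRotate m))

def JoinTrivial {N : ℕ} (σ γ : Equiv.Perm (Fin N)) : Prop :=
  ∀ x y : Fin N, y ∈ MulAction.orbit (Subgroup.closure ({σ, γ} : Set (Equiv.Perm (Fin N)))) x

def IsAnnularNCPerm (n m : ℕ) (σ : Equiv.Perm (Fin (n + m))) : Prop :=
  JoinTrivial σ (annGamma n m) ∧
    cycleCount σ + cycleCount (σ⁻¹ * annGamma n m) + cycleCount (annGamma n m) = (n + m) + 2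

/-- The partition of `[1,n+m]` whose blocks are the cycles (orbits) of `π`. -/
def cyclePartition {N : ℕ} (π : Equiv.Perm (Fin N)) : Setoid (Fin N) :=
  ⟨π.SameCycle, ⟨fun _ => Equiv.Perm.SameCycle.refl _ _, fun h => h.symm, fun h h' => h.trans h'⟩⟩

/-- A through-block of a partition `s` of `[1,n+m]`: a block meeting both
`[1,n]` and `[n+1,n+m]`. -/
def IsThroughBlock (n m : ℕ) (s : Setoid (Fin (n + m))) (B : Set (Fin (n + m))) : Prop :=
  B ∈ s.classes ∧ (∃ i ∈ B, (i : ℕ) < n) ∧ (∃ j ∈ B, n ≤ (j : ℕ))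

namespace ANC
open Equiv Equiv.Perm

set_option linter.unusedSectionVars false

section basic
variable {α : Type*} [Fintype α] [DecidableEq α]

lemma sc_induct (σ : Perm α) (P : α → Prop) {x y : α} (h : SameCycle σ x y)
    (hP : ∀ z, SameCycle σ x z → P z → P (σ z)) (hx : P x) : P y := by
  obtain ⟨i, -, rfl⟩ := h.exists_pow_eq'
  clear h
  induction i with
  | zero => simpa using hx
  | succ i ih =>
    rw [pow_succ', mul_apply]
    exact hP _ ⟨i, by simp⟩ ih

lemma sc_app (σ : Perm α) (x : α) : SameCycle σ x (σ x) := ⟨1, by simp⟩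

lemma mul_swap_left (σ : Perm α) (a b : α) : (σ * swap a b) a = σ b := by simp
lemma mul_swap_right (σ : Perm α) (a b : α) : (σ * swap a b) b = σ a := by simp
lemma mul_swap_ne (σ : Perm α) {a b x : α} (h1 : x ≠ a) (h2 : x ≠ b) :
    (σ * swap a b) x = σ x := by
  rw [mul_apply, swap_apply_of_ne_of_ne h1 h2]

/-- The relation generated by the cycles of `σ` and `a ~ b`. -/
def J (σ : Perm α) (a b x y : α) : Prop :=
  SameCycle σ x y ∨ (SameCycle σ x a ∧ SameCycle σ b y) ∨ (SameCycle σ x b ∧ SameCycle σ a y)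

lemma J_trans {σ : Perm α} {a b x y z : α} (h : J σ a b x y) (h' : J σ a b y z) :
    J σ a b x z := by
  rcases h with h | ⟨h, h1⟩ | ⟨h, h1⟩ <;> rcases h' with h' | ⟨h', h2⟩ | ⟨h', h2⟩
  · exact .inl (h.trans h')
  · exact .inr (.inl ⟨h.trans h', h2⟩)
  · exact .inr (.inr ⟨h.trans h', h2⟩)
  · exact .inr (.inl ⟨h, h1.trans h'⟩)
  · exact .inr (.inl ⟨h, h2⟩)
  · exact .inl (h.trans h2)
  · exact .inr (.inr ⟨h, h1.trans h'⟩)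
  · exact .inl (h.trans h2)
  · exact .inr (.inr ⟨h, h2⟩)

lemma J_of_mul {σ : Perm α} {a b x y : α} (h : SameCycle (σ * swap a b) x y) :
    J σ a b x y := by
  refine sc_induct _ (fun y => J σ a b x y) h ?_ (.inl (SameCycle.refl _ _))
  intro z _ hz
  refine J_trans hz ?_
  by_cases h1 : z = a
  · subst h1
    rw [mul_swap_left]
    exact .inr (.inl ⟨SameCycle.refl _ _, sc_app _ _⟩)
  by_cases h2 : z = b
  · subst h2
    rw [mul_swap_right]
    exact .inr (.inr ⟨SameCycle.refl _ _, sc_app _ _⟩)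
  rw [mul_swap_ne σ h1 h2]
  exact .inl (sc_app _ _)

lemma mul_swap_swap (σ : Perm α) (a b : α) : σ * swap a b * swap a b = σ := by
  rw [mul_assoc, swap_mul_self, mul_one]

lemma J_of_orig {σ : Perm α} {a b x y : α} (h : SameCycle σ x y) :
    J (σ * swap a b) a b x y := by
  apply J_of_mul
  rwa [mul_swap_swap]

lemma merge {σ : Perm α} {a b : α} (h : ¬ SameCycle σ a b) : SameCycle (σ * swap a b) a b := by
  by_contra hc
  refine hc (sc_induct σ (fun z => SameCycle (σ * swap a b) a z) (x := σ b) (y := b)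
    (sc_app σ b).symm ?_ ?_)
  · intro z hz hP
    have h1 : z ≠ a := by
      rintro rfl
      exact h ((sc_app σ b).trans hz).symm
    have h2 : z ≠ b := by
      rintro rfl
      exact hc hP
    rw [← mul_swap_ne σ h1 h2]
    exact hP.trans (sc_app _ _)
  · rw [← mul_swap_left σ a b]
    exact sc_app _ _

lemma split {σ : Perm α} {a b : α} (hab : a ≠ b) (h : SameCycle σ a b) :
    ¬ SameCycle (σ * swap a b) a b := by
  intro hc
  have hex : ∃ k : ℕ, (σ ^ k) a = b := by
    obtain ⟨i, -, hi⟩ := h.exists_pow_eq'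
    exact ⟨i, hi⟩
  classical
  obtain ⟨k, hk, hmin⟩ : ∃ k : ℕ, (σ ^ k) a = b ∧ ∀ j < k, (σ ^ j) a ≠ b :=
    ⟨Nat.find hex, Nat.find_spec hex, fun j hj => Nat.find_min hex hj⟩
  have hk0 : 1 ≤ k := by
    rcases Nat.eq_zero_or_pos k with h0 | h0
    · subst h0; exact absurd hk (by simpa using hab)
    · exact h0
  have hna : ∀ i, 1 ≤ i → i ≤ k → (σ ^ i) a ≠ a := by
    intro i h1 h2 h3
    apply hmin (k - i) (by omega)
    have : (σ ^ (k - i)) ((σ ^ i) a) = b := by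
      rw [← mul_apply, ← pow_add, Nat.sub_add_cancel h2, hk]
    rwa [h3] at this
  have := sc_induct _ (fun z => ∃ i, 1 ≤ i ∧ i ≤ k ∧ (σ ^ i) a = z) hc.symm ?_
    ⟨k, hk0, le_rfl, hk⟩
  · obtain ⟨i, h1, h2, h3⟩ := this
    exact hna i h1 h2 h3
  · rintro z - ⟨i, h1, h2, rfl⟩
    rcases Nat.lt_or_ge i k with hlt | hge
    · refine ⟨i + 1, by omega, by omega, ?_⟩
      rw [mul_swap_ne σ (hna i h1 h2) (hmin i hlt), pow_succ', mul_apply]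
    · have : i = k := by omega
      subst this
      refine ⟨1, le_rfl, hk0, ?_⟩
      rw [hk, mul_swap_right, pow_one]

/-- merging does not destroy relations -/
lemma merge_mono {σ : Perm α} {a b x y : α} (h : ¬ SameCycle σ a b) (hxy : SameCycle σ x y) :
    SameCycle (σ * swap a b) x y := by
  have hm := merge h
  rcases J_of_orig (a := a) (b := b) hxy with h | ⟨h, h1⟩ | ⟨h, h1⟩
  · exact h
  · exact (h.trans hm).trans h1
  · exact (h.trans hm.symm).trans h1

lemma merge_iff {σ : Perm α} {a b x y : α} (h : ¬ SameCycle σ a b) :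
    SameCycle (σ * swap a b) x y ↔ J σ a b x y := by
  refine ⟨J_of_mul, ?_⟩
  have hm := merge h
  rintro (h1 | ⟨h1, h2⟩ | ⟨h1, h2⟩)
  · exact merge_mono h h1
  · exact ((merge_mono h h1).trans hm).trans (merge_mono h h2)
  · exact ((merge_mono h h1).trans hm.symm).trans (merge_mono h h2)

lemma split_le {σ : Perm α} {a b x y : α} (h : SameCycle σ a b)
    (hxy : SameCycle (σ * swap a b) x y) : SameCycle σ x y := by
  rcases J_of_mul hxy with h' | ⟨h', h1⟩ | ⟨h', h1⟩
  · exact h'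
  · exact (h'.trans h).trans h1
  · exact (h'.trans h.symm).trans h1

/-- splitting: elements in the class of a go with a or b. -/
lemma split_or {σ : Perm α} {a b x : α} (h : SameCycle σ a x) :
    SameCycle (σ * swap a b) a x ∨ SameCycle (σ * swap a b) b x := by
  rcases J_of_orig (a := a) (b := b) h with h | ⟨h, h1⟩ | ⟨h, h1⟩
  · exact .inl h
  · exact .inr h1
  · exact .inl h1

lemma split_off {σ : Perm α} {a b x y : α} (hab : SameCycle σ a b) (hx : ¬ SameCycle σ a x)
    (h : SameCycle σ x y) : SameCycle (σ * swap a b) x y := by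
  rcases J_of_orig (a := a) (b := b) h with h | ⟨h, h1⟩ | ⟨h, h1⟩
  · exact h
  · exact absurd (split_le hab h).symm hx
  · exact absurd (hab.trans (split_le hab h).symm) hx

lemma cycleCount_eq (σ : Perm α) :
    cycleCount σ = Nat.card (Quotient (SameCycle.setoid σ)) := by
  classical
  let g : α → α ⊕ Perm α := fun x => if σ x = x then .inl x else .inr (cycleOf σ x)
  have hg : ∀ x y, g x = g y ↔ SameCycle σ x y := by
    intro x y
    simp only [g]
    constructor
    · split_ifs with h1 h2 h2
      · intro h; cases h; exact SameCycle.refl _ _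
      · intro h; cases h
      · intro h; cases h
      · intro h
        have h' := Sum.inr.inj h
        by_contra hc
        have h3 := cycleOf_apply_of_not_sameCycle (f := σ) (x := x) (y := y) hc
        rw [h', cycleOf_apply_self] at h3
        exact h2 h3
    · intro h
      have hf : σ x = x ↔ σ y = y := h.apply_eq_self_iff
      by_cases h1 : σ x = x
      · have : x = y := by
          obtain ⟨i, hi⟩ := h
          rw [zpow_apply_eq_self_of_apply_eq_self h1] at hi
          exact hi
        rw [this]
      · rw [if_neg h1, if_neg (fun h' => h1 (hf.2 h')), h.cycleOf_eq]
  have e : Quotient (SameCycle.setoid σ) ≃ Set.range g := by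
    refine Equiv.ofBijective (Quotient.lift (fun x => ⟨g x, x, rfl⟩) ?_) ⟨?_, ?_⟩
    · intro a b h
      exact Subtype.ext ((hg a b).2 h)
    · intro p q
      induction p using Quotient.inductionOn
      induction q using Quotient.inductionOn
      intro h
      exact Quotient.sound ((hg _ _).1 (congrArg Subtype.val h))
    · rintro ⟨_, x, rfl⟩
      exact ⟨Quotient.mk _ x, rfl⟩
  rw [Nat.card_congr e]
  have hr : Set.range g = ↑((Finset.univ.filter fun x => σ x = x).disjSum σ.cycleFactorsFinset) := by
    ext z
    rcases z with z | z
    · simp only [Set.mem_range, Finset.mem_coe, Finset.inl_mem_disjSum, Finset.mem_filter,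
        Finset.mem_univ, true_and, g]
      constructor
      · rintro ⟨y, hy⟩
        split_ifs at hy with h1
        cases hy; exact h1
      · intro h; exact ⟨z, by rw [if_pos h]⟩
    · simp only [Set.mem_range, Finset.mem_coe, Finset.inr_mem_disjSum, g]
      constructor
      · rintro ⟨y, hy⟩
        split_ifs at hy with h1
        cases hy
        rw [cycleOf_mem_cycleFactorsFinset_iff]
        exact mem_support.2 h1
      · intro h
        have h' := mem_cycleFactorsFinset_iff.1 h
        obtain ⟨y, hy, -⟩ := h'.1
        refine ⟨y, ?_⟩
        have hy' : y ∈ z.support := mem_support.2 hy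
        have := cycle_is_cycleOf hy' h
        rw [if_neg, this]
        rw [← h'.2 y hy']
        exact hy
  rw [hr, Nat.card_coe_set_eq, Set.ncard_coe_finset, Finset.card_disjSum]
  unfold cycleCount
  rw [cycleType_def, Multiset.card_map]
  congr 1
  rw [← Finset.card_compl]
  congr 1
  ext x
  simp

lemma cc_merge {σ : Perm α} {a b : α} (h : ¬ SameCycle σ a b) :
    cycleCount (σ * swap a b) + 1 = cycleCount σ := by
  classical
  rw [cycleCount_eq, cycleCount_eq]
  let f : {q : Quotient (SameCycle.setoid σ) // q ≠ Quotient.mk _ b} →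
      Quotient (SameCycle.setoid (σ * swap a b)) := fun q =>
    Quotient.map (sa := SameCycle.setoid σ) (sb := SameCycle.setoid (σ * swap a b)) id
      (fun x y hxy => merge_mono h hxy) q.1
  have hf : Function.Bijective f := by
    constructor
    · rintro ⟨p, hp⟩ ⟨q, hq⟩ hpq
      induction p using Quotient.inductionOn with | h x => ?_
      induction q using Quotient.inductionOn with | h y => ?_
      have hxy : SameCycle (σ * swap a b) x y := Quotient.exact hpq
      apply Subtype.ext
      apply Quotient.sound
      rcases J_of_mul hxy with h1 | ⟨h1, h2⟩ | ⟨h1, h2⟩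
      · exact h1
      · exact absurd (Quotient.sound h2.symm) hq
      · exact absurd (Quotient.sound h1) hp
    · intro q
      induction q using Quotient.inductionOn with | h x => ?_
      by_cases hx : SameCycle σ x b
      · refine ⟨⟨Quotient.mk _ a, fun h' => h (Quotient.exact h')⟩, ?_⟩
        apply Quotient.sound
        exact (merge h).trans (merge_mono h hx.symm)
      · exact ⟨⟨Quotient.mk _ x, fun h' => hx (Quotient.exact h')⟩, rfl⟩
  rw [← Nat.card_congr (Equiv.ofBijective f hf)]
  have : Fintype (Quotient (SameCycle.setoid σ)) := Fintype.ofFinite _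
  rw [Nat.card_eq_fintype_card, Nat.card_eq_fintype_card]
  rw [Fintype.card_subtype_compl, Fintype.card_subtype_eq]
  have : 0 < Fintype.card (Quotient (SameCycle.setoid σ)) :=
    Fintype.card_pos_iff.2 ⟨Quotient.mk _ b⟩
  omega

lemma cc_split {σ : Perm α} {a b : α} (hab : a ≠ b) (h : SameCycle σ a b) :
    cycleCount (σ * swap a b) = cycleCount σ + 1 := by
  have := cc_merge (split hab h)
  rw [mul_swap_swap] at this
  exact this.symm

lemma cc_inv (σ : Perm α) : cycleCount σ⁻¹ = cycleCount σ := by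
  unfold cycleCount; rw [cycleType_inv, support_inv]

lemma cc_comm (σ τ : Perm α) : cycleCount (σ * τ) = cycleCount (τ * σ) := by
  have : τ * σ = τ * (σ * τ) * τ⁻¹ := by group
  unfold cycleCount; rw [this, cycleType_conj, card_support_conj]

lemma cc_one : cycleCount (1 : Perm α) = Fintype.card α := by simp [cycleCount]

lemma cc_le (σ : Perm α) : cycleCount σ ≤ Fintype.card α := by
  rw [cycleCount_eq]
  have := Nat.card_le_card_of_surjective (Quotient.mk (SameCycle.setoid σ)) Quotient.mk_surjective
  rwa [Nat.card_eq_fintype_card (α := α)] at this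

lemma cc_swap_ge (σ : Perm α) (a b : α) : cycleCount σ ≤ cycleCount (σ * swap a b) + 1 := by
  by_cases h : SameCycle σ a b
  · by_cases hab : a = b
    · subst hab; rw [swap_self]; exact Nat.le_succ _
    · rw [cc_split hab h]; omega
  · rw [cc_merge h]

/-- triangle inequality -/
lemma triangle (σ τ : Perm α) :
    cycleCount σ + cycleCount τ ≤ Fintype.card α + cycleCount (σ * τ) := by
  by_cases h1 : τ = 1
  · subst h1; rw [cc_one, mul_one]; omega
  · obtain ⟨x, hx⟩ : ∃ x, τ x ≠ x := by
      by_contra hc; push Not at hc; exact h1 (Equiv.ext hc)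
    have hs := cc_split (σ := τ) hx.symm (sc_app τ x)
    have hle := cc_le (τ * swap x (τ x))
    have ih := triangle σ (τ * swap x (τ x))
    rw [← mul_assoc] at ih
    have h2 := cc_swap_ge (σ * τ * swap x (τ x)) x (τ x)
    have h3 := cc_swap_ge (σ * τ) x (τ x)
    rw [mul_swap_swap] at h2
    omega
termination_by Fintype.card α - cycleCount τ
decreasing_by omega

end basic

section annular
variable {α : Type*} [Fintype α] [DecidableEq α]

lemma lift_bound (γ ρ μ : Perm α) :
    cycleCount (γ⁻¹ * ρ) + cycleCount (ρ * μ) ≤ Fintype.card α + cycleCount (γ * μ) := by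
  have h := triangle (γ * ρ⁻¹) (ρ * μ)
  have h1 : γ * ρ⁻¹ * (ρ * μ) = γ * μ := by group
  have h2 : cycleCount (γ * ρ⁻¹) = cycleCount (γ⁻¹ * ρ) := by
    rw [cc_comm γ⁻¹ ρ, ← cc_inv (γ * ρ⁻¹), mul_inv_rev, inv_inv]
  rw [h1, h2] at h
  exact h

lemma genus_bound (γ ρ : Perm α) :
    cycleCount ρ + cycleCount (γ⁻¹ * ρ) ≤ Fintype.card α + cycleCount γ := by
  have h := lift_bound γ ρ 1
  rw [mul_one, mul_one] at h
  omega

/-- two splittings increase the count by two -/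
lemma uniq_aux {ρ : Perm α} {x z : α} (hz : SameCycle ρ x z) (hxy : x ≠ ρ x) (hxz : x ≠ z)
    (hyz : ρ x ≠ z) :
    cycleCount (ρ * (swap x (ρ x) * swap x z)) = cycleCount ρ + 2 := by
  have h1 := cc_split (σ := ρ) hxy (sc_app ρ x)
  have hfix : (ρ * swap x (ρ x)) (ρ x) = ρ x := mul_swap_right _ _ _
  have h2 : SameCycle (ρ * swap x (ρ x)) x z := by
    rcases split_or (b := ρ x) hz with h | h
    · exact h
    · obtain ⟨i, hi⟩ := h
      rw [zpow_apply_eq_self_of_apply_eq_self hfix] at hi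
      exact absurd hi hyz
  have h3 := cc_split hxz h2
  rw [← mul_assoc, h3, h1]

/-- A permutation on a geodesic below `γ` is determined by its cycle partition. -/
lemma uniq {γ ρ ρ' : Perm α}
    (h : cycleCount ρ + cycleCount (γ⁻¹ * ρ) = Fintype.card α + cycleCount γ)
    (h' : cycleCount ρ' + cycleCount (γ⁻¹ * ρ') = Fintype.card α + cycleCount γ)
    (hs : ∀ x y, SameCycle ρ x y ↔ SameCycle ρ' x y) : ρ = ρ' := by
  by_contra hne
  obtain ⟨x, hx⟩ : ∃ x, ρ x ≠ ρ' x := by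
    by_contra hc; push Not at hc; exact hne (Equiv.ext hc)
  have fixlem : ∀ σ : Perm α, ∀ w, σ x = x → SameCycle σ x w → x = w := by
    intro σ w hf hw
    obtain ⟨i, hi⟩ := hw
    rwa [zpow_apply_eq_self_of_apply_eq_self hf] at hi
  have hy1 : SameCycle ρ x (ρ' x) := (hs _ _).2 (sc_app _ _)
  have hy2 : SameCycle ρ' x (ρ x) := (hs _ _).1 (sc_app _ _)
  have hxy : x ≠ ρ x := by
    intro he
    exact hx (he.symm.trans (fixlem ρ _ he.symm hy1))
  have hxz : x ≠ ρ' x := by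
    intro he
    exact hx ((fixlem ρ' _ he.symm hy2).symm.trans he)
  have c1 := uniq_aux hy1 hxy hxz hx
  have c2 := uniq_aux hy2 hxz hxy hx.symm
  have b1 := lift_bound γ ρ (swap x (ρ x) * swap x (ρ' x))
  have b2 := lift_bound γ ρ' (swap x (ρ' x) * swap x (ρ x))
  generalize ρ x = y at *
  generalize ρ' x = z at *
  have e1 : swap x y * swap x z = swap y z * swap x y := by
    ext w; simp only [mul_apply, swap_apply_def]; grind
  have e2 : swap x z * swap x y = swap y z * swap x z := by
    ext w; simp only [mul_apply, swap_apply_def]; grind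
  rw [c1, e1, ← mul_assoc] at b1
  rw [c2, e2, ← mul_assoc] at b2
  have b3 : cycleCount (γ * swap y z) ≤ cycleCount γ + 1 := by
    have := cc_swap_ge (γ * swap y z) y z
    rwa [mul_swap_swap] at this
  have q1 : SameCycle (γ * swap y z) x y := by
    by_contra hc
    have := cc_merge hc
    omega
  have q2 : SameCycle (γ * swap y z) x z := by
    by_contra hc
    have := cc_merge hc
    omega
  have q3 := q1.symm.trans q2
  by_cases q4 : SameCycle γ y z
  · exact split hx q4 q3
  · have := cc_merge q4
    have := cc_split hxy q1
    omega

/-- setup -/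
structure Setup (γ : Perm α) (S : α → Bool) : Prop where
  same : ∀ x y, SameCycle γ x y ↔ S x = S y
  two : cycleCount γ = 2

def Good (γ : Perm α) (S : α → Bool) (π : Perm α) : Prop :=
  (∃ x, S (π x) ≠ S x) ∧ cycleCount π + cycleCount (γ⁻¹ * π) = Fintype.card α

variable {γ : Perm α} {S : α → Bool}

lemma Setup.inv_app (hγ : Setup γ S) (x : α) : S (γ⁻¹ x) = S x := by
  rw [← hγ.same]
  have := sc_app γ (γ⁻¹ x)
  simpa using this

lemma pres (hγ : Setup γ S) {ρ : Perm α} (h : ∀ x, S (ρ x) = S x) {x y : α}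
    (hxy : SameCycle (γ⁻¹ * ρ) x y) : S x = S y := by
  refine sc_induct _ (fun z => S x = S z) hxy ?_ rfl
  intro z _ hz
  rw [mul_apply, hγ.inv_app, h]
  exact hz

lemma pres' {ρ : Perm α} (h : ∀ x, S (ρ x) = S x) {x y : α}
    (hxy : SameCycle ρ x y) : S x = S y := by
  refine sc_induct _ (fun z => S x = S z) hxy ?_ rfl
  intro z _ hz
  rw [h]
  exact hz

lemma conn_bound (hγ : Setup γ S) {π : Perm α} (h : ∃ x, S (π x) ≠ S x) :
    cycleCount π + cycleCount (γ⁻¹ * π) ≤ Fintype.card α := by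
  obtain ⟨p, hp⟩ := h
  have hq : S ((γ⁻¹ * π) p) ≠ S p := by
    rw [mul_apply, hγ.inv_app]; exact hp
  set q := (γ⁻¹ * π) p with hqd
  have hpq : p ≠ q := by
    intro he; rw [← he] at hq; exact hq rfl
  have h1 := cc_split (σ := γ⁻¹ * π) hpq (sc_app _ _)
  have h2 := triangle (swap p q * (γ⁻¹ * π)) π⁻¹
  have e : swap p q * (γ⁻¹ * π) * π⁻¹ = swap p q * γ⁻¹ := by group
  rw [e, cc_comm, h1, cc_inv, cc_comm (swap p q)] at h2
  have h3 : ¬ SameCycle γ⁻¹ p q := by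
    rw [sameCycle_inv, hγ.same]; exact hq.symm
  have h4 := cc_merge h3
  rw [cc_inv, hγ.two] at h4
  omega

/-- Each cycle crosses at most once in each direction. -/
lemma cross_unique (hγ : Setup γ S) {π : Perm α} (hπ : Good γ S π) {a a' : α}
    (hs : SameCycle π a a') (ha : S (π a) ≠ S a) (ha' : S (π a') ≠ S a') (hS : S a = S a') :
    a = a' := by
  by_contra hne
  have h1 := cc_split hne hs
  have hay : a ≠ π a' := by
    intro he; rw [← he] at ha'; exact ha' hS
  have hay' : a' ≠ π a := by
    intro he; rw [← he] at ha; exact ha hS.symm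
  have hs1 : SameCycle (π * swap a a') a (π a') := by
    have := sc_app (π * swap a a') a
    rwa [mul_swap_left] at this
  have h2 := cc_split hay hs1
  have hs2 : SameCycle (π * swap a a') a' (π a) := by
    have := sc_app (π * swap a a') a'
    rwa [mul_swap_right] at this
  have hs3 := split_off hs1 (split hne hs) hs2
  have h3 := cc_split hay' hs3
  have hb := lift_bound γ π (swap a a' * swap a (π a') * swap a' (π a))
  have g1s : SameCycle γ a a' := (hγ.same _ _).2 hS
  have g1 := cc_split hne g1s
  have g1n := split hne g1s
  have g2n : ¬ SameCycle (γ * swap a a') a (π a') := by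
    intro h
    have := (hγ.same _ _).1 (split_le g1s h)
    exact ha' (this.symm.trans hS)
  have g2 := cc_merge g2n
  have g3n : ¬ SameCycle (γ * swap a a' * swap a (π a')) a' (π a) := by
    intro h
    rcases J_of_mul h with h | ⟨h, h'⟩ | ⟨h, h'⟩
    · have := (hγ.same _ _).1 (split_le g1s h)
      exact ha (this.symm.trans hS.symm)
    · exact g1n h.symm
    · have := (hγ.same _ _).1 (split_le g1s h)
      exact ha' this.symm
  have g3 := cc_merge g3n
  simp only [← mul_assoc] at hb
  have := hγ.two
  have := hπ.2
  omega

lemma mixed {π : Perm α} {x y : α} (h : SameCycle π x y) (hS : S x ≠ S y) :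
    ∃ a, SameCycle π x a ∧ S a = S x ∧ S (π a) ≠ S a := by
  by_contra hc
  push Not at hc
  apply hS
  refine sc_induct _ (fun z => S x = S z) h ?_ rfl
  intro z hz hP
  rw [hc z hz hP.symm, hP]

lemma partner {π : Perm α} {a : α} (ha : S (π a) ≠ S a) :
    ∃ b, SameCycle π a b ∧ S a ≠ S b ∧ S (π b) ≠ S b := by
  obtain ⟨b, h1, h2, h3⟩ := mixed (S := S) (sc_app π a).symm ha
  exact ⟨b, (sc_app π a).trans h1, by rw [h2]; exact ha.symm, h3⟩

lemma ne_of_S {a b : α} (h : S a ≠ S b) : a ≠ b := fun he => h (by rw [he])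

lemma cut_no_cross (hγ : Setup γ S) {π : Perm α} (hπ : Good γ S π) {a b : α}
    (hs : SameCycle π a b) (hS : S a ≠ S b) (ha : S (π a) ≠ S a) (hb : S (π b) ≠ S b)
    {x : α} (hx : SameCycle π a x) : S ((π * swap a b) x) = S x := by
  by_cases h1 : x = a
  · subst h1
    rw [mul_swap_left]
    revert hS ha hb; cases S x <;> cases S b <;> cases S (π b) <;> simp
  by_cases h2 : x = b
  · subst h2
    rw [mul_swap_right]
    revert hS ha hb; cases S x <;> cases S a <;> cases S (π a) <;> simp
  rw [mul_swap_ne _ h1 h2]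
  by_contra hc
  by_cases h3 : S x = S a
  · exact h1 (cross_unique hγ hπ hx.symm hc ha h3)
  · refine h2 (cross_unique hγ hπ (hx.symm.trans hs) hc hb ?_)
    revert h3 hS; cases S x <;> cases S a <;> cases S b <;> simp

lemma cut_off {π : Perm α} {a b : α} (hs : SameCycle π a b) {x : α} (hx : ¬ SameCycle π a x) :
    (π * swap a b) x = π x := by
  refine mul_swap_ne _ ?_ ?_
  · rintro rfl; exact hx (SameCycle.refl _ _)
  · rintro rfl; exact hx hs

lemma cut_iff (hγ : Setup γ S) {π : Perm α} (hπ : Good γ S π) {a b : α}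
    (hs : SameCycle π a b) (hS : S a ≠ S b) (ha : S (π a) ≠ S a) (hb : S (π b) ≠ S b)
    (x y : α) : SameCycle (π * swap a b) x y ↔
      SameCycle π x y ∧ (SameCycle π a x → S x = S y) := by
  have key : ∀ x y, SameCycle π a x → SameCycle (π * swap a b) x y → S x = S y := by
    intro x y hx hxy
    refine sc_induct _ (fun z => S x = S z) hxy ?_ rfl
    intro z hz hP
    rw [cut_no_cross hγ hπ hs hS ha hb (hx.trans (split_le hs hz))]
    exact hP
  constructor
  · intro h
    exact ⟨split_le hs h, fun hx => key x y hx h⟩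
  · rintro ⟨h, h'⟩
    by_cases hx : SameCycle π a x
    · have hxy := h' hx
      have hy := hx.trans h
      rcases split_or (b := b) hx with h1 | h1 <;> rcases split_or (b := b) hy with h2 | h2
      · exact h1.symm.trans h2
      · exact absurd ((key _ _ (SameCycle.refl _ _) h1).trans
          (hxy.trans (key _ _ hs h2).symm)) hS
      · exact absurd (((key _ _ (SameCycle.refl _ _) h2).trans
          (hxy.symm.trans (key _ _ hs h1).symm))) hS
      · exact h1.symm.trans h2
    · exact split_off hs hx h

lemma cut_good (hγ : Setup γ S) {π : Perm α} (hπ : Good γ S π) {a b : α}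
    (hs : SameCycle π a b) (hS : S a ≠ S b) (hc : ∃ x, S ((π * swap a b) x) ≠ S x) :
    Good γ S (π * swap a b) := by
  refine ⟨hc, ?_⟩
  have h1 := conn_bound hγ hc
  have h2 := cc_split (ne_of_S hS) hs
  have h3 := cc_swap_ge (γ⁻¹ * π) a b
  rw [← mul_assoc] at h1 ⊢
  have h4 := hπ.2
  by_cases h5 : SameCycle (γ⁻¹ * π) a b
  · have := cc_split (ne_of_S hS) h5
    omega
  · have := cc_merge h5
    omega

lemma cut_tight (hγ : Setup γ S) {π : Perm α} (hπ : Good γ S π) {a b : α}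
    (hs : SameCycle π a b) (hS : S a ≠ S b) (hc : ∀ x, S ((π * swap a b) x) = S x) :
    cycleCount (π * swap a b) + cycleCount (γ⁻¹ * (π * swap a b)) =
      Fintype.card α + cycleCount γ := by
  have h2 := cc_split (ne_of_S hS) hs
  have h3 : ¬ SameCycle (γ⁻¹ * (π * swap a b)) a b := fun h => hS (pres hγ hc h)
  have h4 := cc_merge h3
  rw [← mul_assoc, mul_swap_swap] at h4
  rw [← mul_assoc]
  have := hγ.two
  have := hπ.2
  omega

/-- One through-block. -/
lemma one_block (hγ : Setup γ S) {π₀ : Perm α} (h₀ : Good γ S π₀) {a₀ : α}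
    (ha₀ : S (π₀ a₀) ≠ S a₀) (huniq : ∀ x, S (π₀ x) ≠ S x → SameCycle π₀ a₀ x) :
    ∃ ρ : Perm α, ∀ π, (Good γ S π ∧ ∀ x y, SameCycle π x y ↔ SameCycle π₀ x y) ↔
      ∃ a b, (SameCycle π₀ a₀ a ∧ S a = true) ∧ (SameCycle π₀ a₀ b ∧ S b = false) ∧
        ρ * swap a b = π := by
  obtain ⟨b₀, hs₀, hS₀, hb₀⟩ := partner ha₀
  have nocross : ∀ x, S ((π₀ * swap a₀ b₀) x) = S x := by
    intro x
    by_cases hx : SameCycle π₀ a₀ x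
    · exact cut_no_cross hγ h₀ hs₀ hS₀ ha₀ hb₀ hx
    · rw [cut_off hs₀ hx]
      by_contra hc
      exact hx (huniq x hc)
  have tight := cut_tight hγ h₀ hs₀ hS₀ nocross
  have part := cut_iff hγ h₀ hs₀ hS₀ ha₀ hb₀
  refine ⟨π₀ * swap a₀ b₀, fun π => ⟨?_, ?_⟩⟩
  · rintro ⟨hπ, hp⟩
    obtain ⟨a, ha, hat, hac⟩ : ∃ a, SameCycle π a₀ a ∧ S a = true ∧ S (π a) ≠ S a := by
      have hs := (hp _ _).2 hs₀
      by_cases h : S a₀ = true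
      · obtain ⟨a, h1, h2, h3⟩ := mixed (S := S) hs hS₀
        exact ⟨a, h1, h2.trans h, h3⟩
      · obtain ⟨a, h1, h2, h3⟩ := mixed (S := S) hs.symm hS₀.symm
        refine ⟨a, hs.trans h1, ?_, h3⟩
        rw [h2]
        revert h hS₀; cases S a₀ <;> cases S b₀ <;> simp
    obtain ⟨b, hs, hS, hb⟩ := partner hac
    have hbf : S b = false := by
      rw [hat] at hS
      revert hS; cases S b <;> simp
    refine ⟨a, b, ⟨(hp _ _).1 ha, hat⟩, ⟨(hp _ _).1 (ha.trans hs), hbf⟩, ?_⟩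
    have nc : ∀ x, S ((π * swap a b) x) = S x := by
      intro x
      by_cases hx : SameCycle π a x
      · exact cut_no_cross hγ hπ hs hS hac hb hx
      · rw [cut_off hs hx]
        by_contra hc
        obtain ⟨c, h1, -, h3⟩ := mixed (S := S) ((hp _ _).1 (sc_app π x)) (Ne.symm hc)
        apply hx
        have h4 := (hp _ _).2 (huniq c h3)
        have h5 := (hp _ _).2 h1
        exact (ha.symm.trans h4).trans h5.symm
    have tight' := cut_tight hγ hπ hs hS nc
    have part' := cut_iff hγ hπ hs hS hac hb
    have : π₀ * swap a₀ b₀ = π * swap a b := by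
      refine uniq tight tight' fun x y => ?_
      rw [part, part', hp, hp]
      have : SameCycle π₀ a₀ x ↔ SameCycle π₀ a x := by
        have h1 := (hp _ _).1 ha
        exact ⟨fun h => h1.symm.trans h, fun h => h1.trans h⟩
      rw [this]
    rw [this, mul_swap_swap]
  · rintro ⟨a, b, ⟨ha, hat⟩, ⟨hb, hbf⟩, rfl⟩
    have hS : S a ≠ S b := by rw [hat, hbf]; simp
    have n1 : ¬ SameCycle (π₀ * swap a₀ b₀) a b := fun h => hS (pres' nocross h)
    have n2 : ¬ SameCycle (γ⁻¹ * (π₀ * swap a₀ b₀)) a b := fun h => hS (pres hγ nocross h)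
    refine ⟨⟨⟨a, ?_⟩, ?_⟩, fun x y => ?_⟩
    · rw [mul_swap_left, nocross]; exact hS.symm
    · have c1 := cc_merge n1
      have c2 := cc_merge n2
      have := hγ.two
      rw [← mul_assoc γ⁻¹]
      omega
    · rw [merge_iff n1]
      constructor
      · rintro (h | ⟨h, h'⟩ | ⟨h, h'⟩)
        · exact ((part _ _).1 h).1
        · exact (((part _ _).1 h).1.trans (ha.symm.trans hb)).trans ((part _ _).1 h').1
        · exact (((part _ _).1 h).1.trans (hb.symm.trans ha)).trans ((part _ _).1 h').1
      · intro h
        by_cases hx : SameCycle π₀ a₀ x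
        · by_cases hxy : S x = S y
          · exact .inl ((part _ _).2 ⟨h, fun _ => hxy⟩)
          · have hy := hx.trans h
            by_cases hxt : S x = true
            · refine .inr (.inl ⟨(part _ _).2 ⟨hx.symm.trans ha, fun _ => by rw [hxt, hat]⟩,
                (part _ _).2 ⟨hb.symm.trans hy, fun _ => ?_⟩⟩)
              rw [hbf]; rw [hxt] at hxy
              revert hxy; cases S y <;> simp
            · have hxf : S x = false := by revert hxt; cases S x <;> simp
              refine .inr (.inr ⟨(part _ _).2 ⟨hx.symm.trans hb, fun _ => by rw [hxf, hbf]⟩,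
                (part _ _).2 ⟨ha.symm.trans hy, fun _ => ?_⟩⟩)
              rw [hat]; rw [hxf] at hxy
              revert hxy; cases S y <;> simp
        · exact .inl ((part _ _).2 ⟨h, fun h' => absurd h' hx⟩)

lemma base_eq {ρ : Perm α}
    (ht : cycleCount ρ + cycleCount (γ⁻¹ * ρ) = Fintype.card α + cycleCount γ)
    {a1 a1' a2 a2' : α} (h1 : SameCycle ρ a1 a1') (h2 : SameCycle ρ a2 a2')
    (h12 : ¬ SameCycle ρ a1 a2) (k : SameCycle (γ⁻¹ * ρ) a1 a2)
    (k' : SameCycle (γ⁻¹ * ρ) a1' a2') : a1 = a1' := by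
  by_contra hne
  have r1 := cc_split hne h1
  by_cases hk : SameCycle (γ⁻¹ * ρ) a1 a1'
  · have r2 := cc_split hne hk
    have := genus_bound γ (ρ * swap a1 a1')
    rw [← mul_assoc] at this
    omega
  · have hne2 : a2 ≠ a2' := by
      rintro rfl
      exact hk (k.trans k'.symm)
    have r2 := cc_merge hk
    have r3 := cc_split hne2 (split_off h1 h12 h2)
    have s : SameCycle (γ⁻¹ * ρ * swap a1 a1') a2 a2' :=
      ((merge_mono hk k.symm).trans (merge hk)).trans (merge_mono hk k')
    have r4 := cc_split hne2 s
    have := genus_bound γ (ρ * swap a1 a1' * swap a2 a2')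
    simp only [← mul_assoc] at this
    omega

/-- data for exactly two crossing blocks -/
lemma base_conn (hγ : Setup γ S) {ρ : Perm α}
    (ht : cycleCount ρ + cycleCount (γ⁻¹ * ρ) = Fintype.card α + cycleCount γ)
    (hc : ∀ x, S (ρ x) = S x) {a1 b1 a2 b2 : α}
    (hS1 : S a1 = true) (hS2 : S a2 = true) (hT1 : S b1 = false) (hT2 : S b2 = false)
    (h12 : ¬ SameCycle ρ a1 a2)
    (hg : Good γ S (ρ * swap a2 b2 * swap a1 b1)) :
    SameCycle (γ⁻¹ * ρ) a1 a2 ∧ SameCycle (γ⁻¹ * ρ) b1 b2 := by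
  have hd : ∀ {u v}, SameCycle ρ u v → S u = S v := fun h => pres' hc h
  have hd' : ∀ {u v}, SameCycle (γ⁻¹ * ρ) u v → S u = S v := fun h => pres hγ hc h
  have n2 : ¬ SameCycle ρ a2 b2 := fun h => by
    have := hd h; rw [hS2, hT2] at this; cases this
  have n2' : ¬ SameCycle (γ⁻¹ * ρ) a2 b2 := fun h => by
    have := hd' h; rw [hS2, hT2] at this; cases this
  have n1 : ¬ SameCycle (ρ * swap a2 b2) a1 b1 := fun h => by
    rcases J_of_mul h with h | ⟨h, h'⟩ | ⟨h, h'⟩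
    · have := hd h; rw [hS1, hT1] at this; cases this
    · exact h12 h
    · have := hd h; rw [hS1, hT2] at this; cases this
  have c1 := cc_merge n1
  have c2 := cc_merge n2
  have c2' := cc_merge n2'
  have hg2 := hg.2
  have := hγ.two
  simp only [← mul_assoc] at hg2
  have k : SameCycle (γ⁻¹ * ρ * swap a2 b2) a1 b1 := by
    by_contra hcc
    have := cc_merge hcc
    omega
  rcases J_of_mul k with h | ⟨h, h'⟩ | ⟨h, h'⟩
  · have := hd' h; rw [hS1, hT1] at this; cases this
  · exact ⟨h, h'.symm⟩
  · have := hd' h; rw [hS1, hT2] at this; cases this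


lemma pair {π : Perm α} {c x y : α} (hx : SameCycle π c x) (hy : SameCycle π c y)
    (hS : S x ≠ S y) :
    ∃ a b, SameCycle π c a ∧ SameCycle π c b ∧ S a = true ∧ S b = false ∧
      S (π a) ≠ S a ∧ S (π b) ≠ S b := by
  have hxy := hx.symm.trans hy
  obtain ⟨a, h1, h2, h3⟩ := mixed (S := S) hxy hS
  obtain ⟨b, h1', h2', h3'⟩ := mixed (S := S) hxy.symm hS.symm
  by_cases h : S x = true
  · refine ⟨a, b, hx.trans h1, hy.trans h1', h2.trans h, ?_, h3, h3'⟩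
    rw [h2']; revert h hS; cases S x <;> cases S y <;> simp
  · refine ⟨b, a, hy.trans h1', hx.trans h1, ?_, ?_, h3', h3⟩
    · rw [h2']; revert h hS; cases S x <;> cases S y <;> simp
    · rw [h2]; revert h; cases S x <;> simp

lemma two_cut (hγ : Setup γ S) {π : Perm α} (hπ : Good γ S π) {c1 c2 x1 y1 x2 y2 : α}
    (hx1 : SameCycle π c1 x1) (hy1 : SameCycle π c1 y1) (hS1 : S x1 ≠ S y1)
    (hx2 : SameCycle π c2 x2) (hy2 : SameCycle π c2 y2) (hS2 : S x2 ≠ S y2)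
    (h12 : ¬ SameCycle π c1 c2)
    (hall : ∀ x, S (π x) ≠ S x → SameCycle π c1 x ∨ SameCycle π c2 x) :
    ∃ (a1 b1 a2 b2 : α) (ρ : Perm α), S a1 = true ∧ S b1 = false ∧ S a2 = true ∧ S b2 = false ∧
      SameCycle π c1 a1 ∧ SameCycle π c1 b1 ∧ SameCycle π c2 a2 ∧ SameCycle π c2 b2 ∧
      π = ρ * swap a2 b2 * swap a1 b1 ∧
      cycleCount ρ + cycleCount (γ⁻¹ * ρ) = Fintype.card α + cycleCount γ ∧
      (∀ x, S (ρ x) = S x) ∧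
      ∀ x y, SameCycle ρ x y ↔
        SameCycle π x y ∧ (SameCycle π c1 x ∨ SameCycle π c2 x → S x = S y) := by
  obtain ⟨a1, b1, ha1, hb1, hSa1, hSb1, ca1, cb1⟩ := pair hx1 hy1 hS1
  obtain ⟨a2, b2, ha2, hb2, hSa2, hSb2, ca2, cb2⟩ := pair hx2 hy2 hS2
  have hab1 : S a1 ≠ S b1 := by rw [hSa1, hSb1]; simp
  have hab2 : S a2 ≠ S b2 := by rw [hSa2, hSb2]; simp
  have s1 := ha1.symm.trans hb1
  have s2 := ha2.symm.trans hb2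
  have n2 : ¬ SameCycle π a1 a2 := fun h => h12 ((ha1.trans h).trans ha2.symm)
  have n3 : ¬ SameCycle π a1 b2 := fun h => h12 ((ha1.trans h).trans hb2.symm)
  have p1 := cut_iff hγ hπ s1 hab1 ca1 cb1
  have ea2 := cut_off s1 n2
  have eb2 := cut_off s1 n3
  have ca2' : S ((π * swap a1 b1) a2) ≠ S a2 := by rw [ea2]; exact ca2
  have cb2' : S ((π * swap a1 b1) b2) ≠ S b2 := by rw [eb2]; exact cb2
  have g1 := cut_good hγ hπ s1 hab1 ⟨a2, ca2'⟩
  have s2' := split_off s1 n2 s2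
  have p2 := cut_iff hγ g1 s2' hab2 ca2' cb2'
  have nc : ∀ x, S ((π * swap a1 b1 * swap a2 b2) x) = S x := by
    intro x
    by_cases hx : SameCycle (π * swap a1 b1) a2 x
    · exact cut_no_cross hγ g1 s2' hab2 ca2' cb2' hx
    · rw [cut_off s2' hx]
      by_cases hx1 : SameCycle π a1 x
      · exact cut_no_cross hγ hπ s1 hab1 ca1 cb1 hx1
      · rw [cut_off s1 hx1]
        by_contra hc
        rcases hall x hc with h | h
        · exact hx1 (ha1.symm.trans h)
        · exact hx (split_off s1 n2 (ha2.symm.trans h))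
  refine ⟨a1, b1, a2, b2, π * swap a1 b1 * swap a2 b2, hSa1, hSb1, hSa2, hSb2, ha1, hb1, ha2, hb2,
    by rw [mul_swap_swap, mul_swap_swap], cut_tight hγ g1 s2' hab2 nc, nc, fun x y => ?_⟩
  rw [p2, p1, p1]
  constructor
  · rintro ⟨⟨h, h1⟩, h2⟩
    refine ⟨h, ?_⟩
    rintro (h3 | h3)
    · exact h1 (ha1.symm.trans h3)
    · exact h2 ⟨ha2.symm.trans h3, fun h4 => absurd h4 n2⟩
  · rintro ⟨h, h1⟩
    exact ⟨⟨h, fun h2 => h1 (.inl (ha1.trans h2))⟩, fun h2 => h1 (.inr (ha2.trans h2.1))⟩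

lemma multi_base (hγ : Setup γ S) {π π' : Perm α} (hπ : Good γ S π) (hπ' : Good γ S π')
    (hp : ∀ x y, SameCycle π' x y ↔ SameCycle π x y) {c1 c2 : α}
    (h1 : S (π c1) ≠ S c1) (h2 : S (π c2) ≠ S c2) (h12 : ¬ SameCycle π c1 c2)
    (hall : ∀ x, S (π x) ≠ S x → SameCycle π c1 x ∨ SameCycle π c2 x) : π = π' := by
  have hall' : ∀ x, S (π' x) ≠ S x → SameCycle π' c1 x ∨ SameCycle π' c2 x := by
    intro x hx
    obtain ⟨c, k1, -, k3⟩ := mixed (S := S) ((hp _ _).1 (sc_app π' x)) (Ne.symm hx)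
    rw [hp, hp]
    exact (hall c k3).imp (fun h => h.trans k1.symm) (fun h => h.trans k1.symm)
  obtain ⟨a1, b1, a2, b2, ρ, A1, B1, A2, B2, sa1, sb1, sa2, sb2, e, t, nc, p⟩ :=
    two_cut hγ hπ (SameCycle.refl _ _) (sc_app π c1) h1.symm (SameCycle.refl _ _) (sc_app π c2)
      h2.symm h12 hall
  obtain ⟨a1', b1', a2', b2', ρ', A1', B1', A2', B2', sa1', sb1', sa2', sb2', e', t', nc', p'⟩ :=
    two_cut hγ hπ' (SameCycle.refl _ _) ((hp _ _).2 (sc_app π c1)) h1.symm (SameCycle.refl _ _)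
      ((hp _ _).2 (sc_app π c2)) h2.symm (fun h => h12 ((hp _ _).1 h)) hall'
  have hρ : ρ = ρ' := by
    refine uniq t t' fun x y => ?_
    rw [p, p', hp, hp, hp]
  subst hρ
  rw [hp] at sa1' sb1' sa2' sb2'
  have m : ∀ {u v c c' : α}, SameCycle π c u → SameCycle π c' v → SameCycle ρ u v →
      SameCycle π c c' := fun hu hv h => (hu.trans ((p _ _).1 h).1).trans hv.symm
  have w : ∀ {u v c : α}, SameCycle π c u → SameCycle π c v → S u = S v → SameCycle ρ u v :=
    fun hu hv h => (p _ _).2 ⟨hu.symm.trans hv, fun _ => h⟩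
  obtain ⟨ka, kb⟩ := base_conn hγ t nc A1 A2 B1 B2 (fun h => h12 (m sa1 sa2 h)) (e ▸ hπ)
  obtain ⟨ka', kb'⟩ := base_conn hγ t nc A1' A2' B1' B2' (fun h => h12 (m sa1' sa2' h)) (e' ▸ hπ')
  have wa1 := w sa1 sa1' (A1.trans A1'.symm)
  have wa2 := w sa2 sa2' (A2.trans A2'.symm)
  have wb1 := w sb1 sb1' (B1.trans B1'.symm)
  have wb2 := w sb2 sb2' (B2.trans B2'.symm)
  have q1 := base_eq t wa1 wa2 (fun h => h12 (m sa1 sa2 h)) ka ka'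
  have q2 := base_eq t wa2 wa1 (fun h => h12 (m sa2 sa1 h).symm) ka.symm ka'.symm
  have q3 := base_eq t wb1 wb2 (fun h => h12 (m sb1 sb2 h)) kb kb'
  have q4 := base_eq t wb2 wb1 (fun h => h12 (m sb2 sb1 h).symm) kb.symm kb'.symm
  rw [e, e', q1, q2, q3, q4]

lemma multi (hγ : Setup γ S) : ∀ (k : ℕ) (π π' : Perm α), Good γ S π → Good γ S π' →
    (∀ x y, SameCycle π' x y ↔ SameCycle π x y) → ∀ c1 c2 : α,
    S (π c1) ≠ S c1 → S (π c2) ≠ S c2 → ¬ SameCycle π c1 c2 →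
    (Finset.univ.filter fun x => S (π x) ≠ S x).card = k → π = π' := by
  intro k
  induction k using Nat.strong_induction_on with
  | _ k ih =>
  intro π π' hπ hπ' hp c1 c2 h1 h2 h12 hk
  by_cases hall : ∀ x, S (π x) ≠ S x → SameCycle π c1 x ∨ SameCycle π c2 x
  · exact multi_base hγ hπ hπ' hp h1 h2 h12 hall
  push Not at hall
  obtain ⟨c3, h3, h13, h23⟩ := hall
  have step : ∀ c d e x : α, S (π c) ≠ S c → S (π d) ≠ S d → S (π e) ≠ S e →
      ¬ SameCycle π c d → ¬ SameCycle π c e → ¬ SameCycle π d e → ¬ SameCycle π c x →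
      π x = π' x := by
    intro c d e x hc hd he hcd hce hde hcx
    obtain ⟨b, hs, hS, hb⟩ := partner hc
    obtain ⟨a', b', ha', hb', hSa', hSb', ca', cb'⟩ :=
      pair ((hp _ _).2 (SameCycle.refl π c)) ((hp _ _).2 hs) hS
    have hs' := ha'.symm.trans hb'
    have hS' : S a' ≠ S b' := by rw [hSa', hSb']; simp
    have part := cut_iff hγ hπ hs hS hc hb
    have part' := cut_iff hγ hπ' hs' hS' ca' cb'
    have eqv : ∀ z, SameCycle π' a' z ↔ SameCycle π c z := by
      intro z
      rw [← hp c z]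
      exact ⟨fun h => ha'.trans h, fun h => ha'.symm.trans h⟩
    have hd1 : S ((π * swap c b) d) ≠ S d := by rw [cut_off hs hcd]; exact hd
    have he1 : S ((π * swap c b) e) ≠ S e := by rw [cut_off hs hce]; exact he
    have g := cut_good hγ hπ hs hS ⟨d, hd1⟩
    obtain ⟨d', k1, -, k3⟩ := mixed (S := S) ((hp _ _).2 (sc_app π d)) hd.symm
    have hd1' : S ((π' * swap a' b') d') ≠ S d' := by
      rw [cut_off hs']
      · exact k3
      · rw [eqv]
        exact fun h => hcd (h.trans ((hp _ _).1 k1).symm)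
    have g' := cut_good hγ hπ' hs' hS' ⟨d', hd1'⟩
    have hlt : (Finset.univ.filter fun x => S ((π * swap c b) x) ≠ S x).card < k := by
      rw [← hk]
      apply Finset.card_lt_card
      rw [Finset.ssubset_iff_of_subset]
      · refine ⟨c, by simpa using hc, ?_⟩
        have := cut_no_cross hγ hπ hs hS hc hb (SameCycle.refl π c)
        exact fun hm => (Finset.mem_filter.1 hm).2 this
      · intro z hz
        have hz' := (Finset.mem_filter.1 hz).2
        refine Finset.mem_filter.2 ⟨Finset.mem_univ _, ?_⟩
        by_cases hcz : SameCycle π c z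
        · exact absurd (cut_no_cross hγ hπ hs hS hc hb hcz) hz'
        · rwa [cut_off hs hcz] at hz'
    have := ih _ hlt _ _ g g' (fun u v => by rw [part, part', hp, eqv]) d e hd1 he1
      (fun h => hde (split_le hs h)) rfl
    rw [← cut_off hs hcx, this, cut_off hs']
    rw [eqv]; exact hcx
  ext x
  by_cases hx : SameCycle π c1 x
  · exact step c2 c1 c3 x h2 h1 h3 (fun h => h12 h.symm) h23 h13
      (fun h => h12 (hx.trans h.symm))
  · exact step c1 c2 c3 x h1 h2 h3 h12 h13 h23 hx

end annular

section concrete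

def side (n m : ℕ) (i : Fin (n + m)) : Bool := decide ((i : ℕ) < n)

lemma rot_same (n : ℕ) (i j : Fin n) : SameCycle (finRotate n) i j := by
  cases n with
  | zero => exact i.elim0
  | succ n =>
    have h : ∀ k (hk : k < n + 1), SameCycle (finRotate (n + 1)) 0 ⟨k, hk⟩ := by
      intro k
      induction k with
      | zero => intro hk; exact SameCycle.refl _ _
      | succ k ih =>
        intro hk
        have h1 := ih (by omega)
        have h2 : finRotate (n + 1) ⟨k, by omega⟩ = ⟨k + 1, hk⟩ := finRotate_of_lt (by omega)
        rw [← h2]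
        exact h1.trans (sc_app _ _)
    exact (h i.1 i.2).symm.trans (h j.1 j.2)

lemma gamma_castAdd (n m : ℕ) (i : Fin n) :
    annGamma n m (Fin.castAdd m i) = Fin.castAdd m (finRotate n i) := by
  simp [annGamma, Equiv.permCongr_apply]

lemma gamma_natAdd (n m : ℕ) (i : Fin m) :
    annGamma n m (Fin.natAdd n i) = Fin.natAdd n (finRotate m i) := by
  simp [annGamma, Equiv.permCongr_apply]

lemma side_castAdd (n m : ℕ) (i : Fin n) : side n m (Fin.castAdd m i) = true := by
  simp [side]

lemma side_natAdd (n m : ℕ) (i : Fin m) : side n m (Fin.natAdd n i) = false := by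
  simp [side]

lemma gamma_side (n m : ℕ) (x : Fin (n + m)) : side n m (annGamma n m x) = side n m x := by
  induction x using Fin.addCases with
  | left i => rw [gamma_castAdd, side_castAdd, side_castAdd]
  | right i => rw [gamma_natAdd, side_natAdd, side_natAdd]

lemma gamma_same (n m : ℕ) (x y : Fin (n + m)) :
    SameCycle (annGamma n m) x y ↔ side n m x = side n m y := by
  constructor
  · exact pres' (gamma_side n m)
  · induction x using Fin.addCases with
    | left i =>
      induction y using Fin.addCases with
      | left j =>
        intro _
        refine sc_induct _ (fun z => SameCycle (annGamma n m) (Fin.castAdd m i) (Fin.castAdd m z))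
          (rot_same n i j) ?_ (SameCycle.refl _ _)
        intro z _ hz
        rw [← gamma_castAdd]
        exact hz.trans (sc_app _ _)
      | right j => rw [side_castAdd, side_natAdd]; intro h; cases h
    | right i =>
      induction y using Fin.addCases with
      | left j => rw [side_castAdd, side_natAdd]; intro h; cases h
      | right j =>
        intro _
        refine sc_induct _ (fun z => SameCycle (annGamma n m) (Fin.natAdd n i) (Fin.natAdd n z))
          (rot_same m i j) ?_ (SameCycle.refl _ _)
        intro z _ hz
        rw [← gamma_natAdd]
        exact hz.trans (sc_app _ _)

lemma gamma_setup (n m : ℕ) (hn : 1 ≤ n) (hm : 1 ≤ m) : Setup (annGamma n m) (side n m) := by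
  refine ⟨gamma_same n m, ?_⟩
  rw [cycleCount_eq]
  have e : Quotient (SameCycle.setoid (annGamma n m)) ≃ Bool := by
    refine Equiv.ofBijective (Quotient.lift (side n m) fun a b h => (gamma_same n m a b).1 h)
      ⟨?_, ?_⟩
    · intro p q
      induction p using Quotient.inductionOn
      induction q using Quotient.inductionOn
      intro h
      exact Quotient.sound ((gamma_same n m _ _).2 h)
    · intro b
      cases b
      · exact ⟨Quotient.mk _ (Fin.natAdd n ⟨0, hm⟩), side_natAdd _ _ _⟩
      · exact ⟨Quotient.mk _ (Fin.castAdd m ⟨0, hn⟩), side_castAdd _ _ _⟩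
  rw [Nat.card_congr e]
  simp

lemma annular_iff (n m : ℕ) (hn : 1 ≤ n) (hm : 1 ≤ m) (π : Perm (Fin (n + m))) :
    IsAnnularNCPerm n m π ↔ Good (annGamma n m) (side n m) π := by
  have hγ := gamma_setup n m hn hm
  unfold IsAnnularNCPerm Good
  have hc : cycleCount (π⁻¹ * annGamma n m) = cycleCount ((annGamma n m)⁻¹ * π) := by
    rw [← cc_inv, mul_inv_rev, inv_inv]
  rw [hc, hγ.two, Fintype.card_fin]
  refine and_congr ⟨?_, ?_⟩ (by omega)
  · intro hJ
    by_contra hno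
    push Not at hno
    have key : ∀ g ∈ Subgroup.closure ({π, annGamma n m} : Set (Perm (Fin (n + m)))),
        ∀ x, side n m (g x) = side n m x := by
      intro g hg
      induction hg using Subgroup.closure_induction with
      | mem g hg =>
        rcases hg with rfl | rfl
        · exact hno
        · exact gamma_side n m
      | one => intro x; rfl
      | mul g h _ _ h1 h2 => intro x; rw [mul_apply, h1, h2]
      | inv g _ h1 => intro x; rw [← h1 (g⁻¹ x)]; simp
    obtain ⟨⟨g, hg⟩, h⟩ := hJ (Fin.castAdd m ⟨0, hn⟩) (Fin.natAdd n ⟨0, hm⟩)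
    have h1 := key g hg (Fin.castAdd m ⟨0, hn⟩)
    have h2 : g (Fin.castAdd m ⟨0, hn⟩) = Fin.natAdd n ⟨0, hm⟩ := h
    rw [h2, side_natAdd, side_castAdd] at h1
    cases h1
  · rintro ⟨c, hc⟩
    set G := Subgroup.closure ({π, annGamma n m} : Set (Perm (Fin (n + m)))) with hG
    have hπ : π ∈ G := Subgroup.subset_closure (by simp)
    have hg : annGamma n m ∈ G := Subgroup.subset_closure (by simp)
    have h1 : ∀ x y, side n m x = side n m y → x ∈ MulAction.orbit G y := by
      intro x y h
      obtain ⟨i, hi⟩ := (gamma_same n m y x).2 h.symm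
      exact ⟨⟨annGamma n m ^ i, G.zpow_mem hg i⟩, hi⟩
    have h2 : MulAction.orbit G (π c) = MulAction.orbit G c :=
      MulAction.orbit_eq_iff.2 ⟨⟨π, hπ⟩, rfl⟩
    have h3 : ∀ x, MulAction.orbit G x = MulAction.orbit G c := by
      intro x
      by_cases hx : side n m x = side n m c
      · exact MulAction.orbit_eq_iff.2 (h1 _ _ hx)
      · rw [← h2]
        refine MulAction.orbit_eq_iff.2 (h1 _ _ ?_)
        revert hx hc; cases side n m x <;> cases side n m c <;> cases side n m (π c) <;> simp
    intro x y
    rw [h3 x, ← h3 y]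
    exact MulAction.mem_orbit_self y

lemma partition_iff {N : ℕ} (π : Perm (Fin N)) (s : Setoid (Fin N)) :
    cyclePartition π = s ↔ ∀ x y, SameCycle π x y ↔ s x y := by
  constructor
  · rintro rfl x y; rfl
  · intro h; exact Setoid.ext h

end concrete
end ANC

/-- if an annular non-crossing partition `s ∈ NC(n,m)` has exactly one
through-block `B = B' ∪ B''`, then exactly `|B'|·|B''|` annular non-crossing
permutations have cycle decomposition `s`; if `s` has more than one through-block,
there is exactly one such permutation. -/
theorem count_annular_noncrossing_perms_over_partition (n m : ℕ) (hn : 1 ≤ n) (hm : 1 ≤ m)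
    (s : Setoid (Fin (n + m)))
    (hNC : ∃ π₀ : Equiv.Perm (Fin (n + m)), IsAnnularNCPerm n m π₀ ∧ cyclePartition π₀ = s) :
    (∀ B : Set (Fin (n + m)), IsThroughBlock n m s B →
      (∀ B' : Set (Fin (n + m)), IsThroughBlock n m s B' → B' = B) →
      {π : Equiv.Perm (Fin (n + m)) |
          IsAnnularNCPerm n m π ∧ cyclePartition π = s}.ncard =
        (B ∩ {i | (i : ℕ) < n}).ncard * (B ∩ {j | n ≤ (j : ℕ)}).ncard) ∧
    (∀ B₁ B₂ : Set (Fin (n + m)), IsThroughBlock n m s B₁ → IsThroughBlock n m s B₂ →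
      B₁ ≠ B₂ →
      {π : Equiv.Perm (Fin (n + m)) |
          IsAnnularNCPerm n m π ∧ cyclePartition π = s}.ncard = 1) := by
  classical
  obtain ⟨π₀, h₀, rfl⟩ := hNC
  have hγ := ANC.gamma_setup n m hn hm
  rw [ANC.annular_iff n m hn hm] at h₀
  have hset : {π : Equiv.Perm (Fin (n + m)) |
      IsAnnularNCPerm n m π ∧ cyclePartition π = cyclePartition π₀} =
      {π | ANC.Good (annGamma n m) (ANC.side n m) π ∧
        ∀ x y, π.SameCycle x y ↔ π₀.SameCycle x y} := by
    ext π
    simp only [Set.mem_setOf_eq]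
    rw [ANC.annular_iff n m hn hm, ANC.partition_iff]
    rfl
  rw [hset]
  have hlt : ∀ i : Fin (n + m), ANC.side n m i = true ↔ (i : ℕ) < n := by
    intro i; simp [ANC.side]
  have hge : ∀ i : Fin (n + m), ANC.side n m i = false ↔ n ≤ (i : ℕ) := by
    intro i; simp [ANC.side]
  -- every through block is the cycle of a crossing point
  have hthrough : ∀ B, IsThroughBlock n m (cyclePartition π₀) B →
      ∃ a, ANC.side n m (π₀ a) ≠ ANC.side n m a ∧ ∀ x, x ∈ B ↔ π₀.SameCycle a x := by
    rintro B ⟨⟨c, rfl⟩, ⟨i, hi, hi'⟩, ⟨j, hj, hj'⟩⟩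
    have hi1 : π₀.SameCycle i c := hi
    have hj1 : π₀.SameCycle j c := hj
    have hS : ANC.side n m i ≠ ANC.side n m j := by
      rw [(hlt i).2 hi', (hge j).2 hj']; simp
    obtain ⟨a, k1, -, k3⟩ := ANC.mixed (S := ANC.side n m) (hi1.trans hj1.symm) hS
    refine ⟨a, k3, fun x => ?_⟩
    have hac := k1.symm.trans hi1
    exact ⟨fun h => hac.trans (Equiv.Perm.SameCycle.symm h), fun h => h.symm.trans hac⟩
  have hcross : ∀ a, ANC.side n m (π₀ a) ≠ ANC.side n m a →
      IsThroughBlock n m (cyclePartition π₀) {x | π₀.SameCycle x a} := by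
    intro a ha
    refine ⟨⟨a, rfl⟩, ?_⟩
    have h1 : π₀.SameCycle a a := Equiv.Perm.SameCycle.refl _ _
    obtain ⟨u, v, hu, hv, hSu, hSv, -, -⟩ := ANC.pair h1 (ANC.sc_app π₀ a) ha.symm
    exact ⟨⟨u, hu.symm, (hlt u).1 hSu⟩, ⟨v, hv.symm, (hge v).1 hSv⟩⟩
  constructor
  · intro B hB huniq
    obtain ⟨a₀, ha₀, hmem⟩ := hthrough B hB
    obtain ⟨ρ, hρ⟩ := ANC.one_block hγ h₀ ha₀ (by
      intro x hx
      have h1 := huniq _ (hcross x hx)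
      rw [← hmem, ← h1]
      exact Equiv.Perm.SameCycle.refl _ _)
    have himg : {π | ANC.Good (annGamma n m) (ANC.side n m) π ∧
        ∀ x y, π.SameCycle x y ↔ π₀.SameCycle x y} =
        (fun p : Fin (n + m) × Fin (n + m) => ρ * Equiv.swap p.1 p.2) ''
          ((B ∩ {i | (i : ℕ) < n}) ×ˢ (B ∩ {j | n ≤ (j : ℕ)})) := by
      ext π
      rw [Set.mem_setOf_eq, hρ]
      simp only [Set.mem_image, Set.mem_prod, Set.mem_inter_iff, Set.mem_setOf_eq, Prod.exists,
        hmem, hlt, hge, and_assoc]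
    rw [himg, Set.ncard_image_of_injOn, Set.ncard_prod]
    rintro ⟨a, b⟩ ⟨⟨-, ha⟩, ⟨-, hb⟩⟩ ⟨a', b'⟩ ⟨⟨-, ha'⟩, ⟨-, hb'⟩⟩ h
    have hsw : Equiv.swap a b = Equiv.swap a' b' := mul_left_cancel h
    simp only [Set.mem_setOf_eq] at ha hb ha' hb'
    have hv : Equiv.swap a' b' a = b := by rw [← hsw]; simp
    have hab : a ≠ b := by rintro rfl; omega
    have hab' : a ≠ b' := by rintro rfl; omega
    by_cases haa : a = a'
    · subst haa
      rw [Equiv.swap_apply_left] at hv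
      rw [hv]
    · rw [Equiv.swap_apply_of_ne_of_ne haa hab'] at hv
      exact absurd hv hab
  · intro B₁ B₂ hB₁ hB₂ hne
    obtain ⟨c1, h1, m1⟩ := hthrough B₁ hB₁
    obtain ⟨c2, h2, m2⟩ := hthrough B₂ hB₂
    have h12 : ¬ π₀.SameCycle c1 c2 := by
      intro h
      apply hne
      ext x
      rw [m1, m2]
      exact ⟨fun h' => h.symm.trans h', fun h' => h.trans h'⟩
    rw [Set.ncard_eq_one]
    refine ⟨π₀, ?_⟩
    ext π
    rw [Set.mem_setOf_eq, Set.mem_singleton_iff]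
    constructor
    · rintro ⟨hπ, hp⟩
      exact (ANC.multi hγ _ π₀ π h₀ hπ hp c1 c2 h1 h2 h12 rfl).symm
    · rintro rfl
      exact ⟨h₀, fun _ _ => Iff.rfl⟩
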